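/- Let m ≥ 1, let A, B ∈ ℤ^m with B·e > 0 for all nonzero e in the orthant ℕ_0^m, and let γ : cells → ℤ^m be piecewise constant on a polyhedral cell complex whose cone is the standard orthant C = ℝ_{≥0}^m with bounding hyperplanes {e_i = 0} and finitely many rational internal hyperplanes. For I ⊆ [m] define E_I(q, q^{−s}) = ∑_{e ∈ C_I ∩ ℤ^m} q^{(A+γ(F_e))·e − (B·e)s}. Then each E_I is a rational function of q and q^{−s}, and E_I(q,q^{−s})|_{q→q^{−1}} = (−1)^m E_{[m]∖I}(q, q^{−s}). -/

import Mathlib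

/-- Integer dot product. -/
def zdot {m : ℕ} (a b : Fin m → ℤ) : ℤ := ∑ i, a i * b i

/-- Two lattice points of the orthant lie in the same cell of the complex
(bounding hyperplanes `{eᵢ = 0}`, internal hyperplanes given by the forms `w j`). -/
def zSameCell {m κ : ℕ} (w : Fin κ → (Fin m → ℤ)) (e e' : Fin m → ℤ) : Prop :=
  (∀ i, (e i = 0 ↔ e' i = 0)) ∧ ∀ j, (zdot (w j) e).sign = (zdot (w j) e').sign

/-- `e'` lies in the closure of the cell containing `e` (both in the orthant). -/
def zInClosure {m κ : ℕ} (w : Fin κ → (Fin m → ℤ)) (e e' : Fin m → ℤ) : Prop :=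
  (∀ i, e i = 0 → e' i = 0) ∧
    ∀ j, (zdot (w j) e = 0 → zdot (w j) e' = 0) ∧
      (0 < zdot (w j) e → 0 ≤ zdot (w j) e') ∧
      (zdot (w j) e < 0 → zdot (w j) e' ≤ 0)

open scoped Matrix

section HalfOpenCones

variable {m : ℕ}

theorem zdot_eq_dotProduct (a b : Fin m → ℤ) : zdot a b = a ⬝ᵥ b := rfl

/-- Positivity of the pair `(x, y)` in the lexicographic order, that is, positivity of `x + ε * y`
for all sufficiently small `ε > 0`. -/
def LexPos (x y : ℝ) : Prop := 0 < x ∨ (x = 0 ∧ 0 < y)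

namespace LexPos

theorem nonneg {x y : ℝ} (h : LexPos x y) : 0 ≤ x := by
  rcases h with h | ⟨h, -⟩ <;> linarith

theorem add {x y x' y' : ℝ} (h : LexPos x y) (h' : LexPos x' y') : LexPos (x + x') (y + y') := by
  unfold LexPos at *
  rcases h with h | ⟨h, h1⟩ <;> rcases h' with h' | ⟨h', h1'⟩
  · left; linarith
  · left; linarith
  · left; linarith
  · right; constructor <;> linarith

theorem mul_iff {c x y : ℝ} (hc : 0 < c) : LexPos (c * x) (c * y) ↔ LexPos x y := by
  simp [LexPos, hc, hc.ne']

theorem neg_iff {x y : ℝ} (hy : y ≠ 0) : LexPos (-x) (-y) ↔ ¬ LexPos x y := by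
  unfold LexPos
  rcases lt_trichotomy x 0 with h | rfl | h
  · simp [h, h.not_gt, h.ne]
  · rcases lt_or_gt_of_ne hy with h | h <;> simp [h, h.not_gt]
  · simp [h, h.not_gt, h.ne']

end LexPos

/-- The coordinates of `x` with respect to the rows of the integral matrix `a`. -/
noncomputable def rowCoord (a : Fin m → Fin m → ℤ) (x : Fin m → ℝ) : Fin m → ℝ :=
  x ᵥ* ((Matrix.of a).map (Int.cast : ℤ → ℝ))⁻¹

theorem isUnit_det_map_intCast {a : Fin m → Fin m → ℤ} (ha : (Matrix.of a).det ≠ 0) :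
    IsUnit ((Matrix.of a).map (Int.cast : ℤ → ℝ)).det := by
  rw [isUnit_iff_ne_zero]
  have h : ((Matrix.of a).map (Int.cast : ℤ → ℝ)).det = (((Matrix.of a).det : ℤ) : ℝ) := by
    exact ((Int.castRingHom ℝ).map_det (Matrix.of a)).symm
  rw [h]
  exact_mod_cast ha

theorem rowCoord_vecMul {a : Fin m → Fin m → ℤ} (ha : (Matrix.of a).det ≠ 0) (x : Fin m → ℝ) :
    rowCoord a x ᵥ* (Matrix.of a).map (Int.cast : ℤ → ℝ) = x := by
  rw [rowCoord, Matrix.vecMul_vecMul, Matrix.nonsing_inv_mul _ (isUnit_det_map_intCast ha),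
    Matrix.vecMul_one]

theorem rowCoord_eq {a : Fin m → Fin m → ℤ} (ha : (Matrix.of a).det ≠ 0) {x c : Fin m → ℝ}
    (h : c ᵥ* (Matrix.of a).map (Int.cast : ℤ → ℝ) = x) : rowCoord a x = c := by
  rw [← h, rowCoord, Matrix.vecMul_vecMul, Matrix.mul_nonsing_inv _ (isUnit_det_map_intCast ha),
    Matrix.vecMul_one]

theorem sum_rowCoord {a : Fin m → Fin m → ℤ} (ha : (Matrix.of a).det ≠ 0) (x : Fin m → ℝ) (k : Fin m) :
    ∑ i, rowCoord a x i * (a i k : ℝ) = x k :=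
  congrFun (rowCoord_vecMul ha x) k

theorem rowCoord_row {a : Fin m → Fin m → ℤ} (ha : (Matrix.of a).det ≠ 0) (k : Fin m) :
    rowCoord a (fun l => (a k l : ℝ)) = Pi.single k 1 := by
  apply rowCoord_eq ha
  ext l
  simp [Matrix.row]

theorem rowCoord_sub (a : Fin m → Fin m → ℤ) (x y : Fin m → ℝ) :
    rowCoord a (x - y) = rowCoord a x - rowCoord a y := Matrix.sub_vecMul _ _ _

theorem rowCoord_neg (a : Fin m → Fin m → ℤ) (x : Fin m → ℝ) :
    rowCoord a (-x) = -rowCoord a x := Matrix.neg_vecMul _ _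

theorem rowCoord_sum_rows {a : Fin m → Fin m → ℤ} (ha : (Matrix.of a).det ≠ 0) :
    rowCoord a (fun l => ((∑ i, a i l : ℤ) : ℝ)) = 1 := by
  apply rowCoord_eq ha
  ext l
  simp [Matrix.vecMul, dotProduct]

/-- A real vector satisfying no nontrivial integral linear relation. -/
def IsGeneric (v : Fin m → ℝ) : Prop := ∀ c : Fin m → ℤ, ∑ i, (c i : ℝ) * v i = 0 → c = 0

theorem IsGeneric.rowCoord_ne_zero {v : Fin m → ℝ} (hv : IsGeneric v)
    {a : Fin m → Fin m → ℤ} (ha : (Matrix.of a).det ≠ 0) (i : Fin m) : rowCoord a v i ≠ 0 := by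
  intro h0
  have hdet : ((Matrix.of a).updateRow i 0).det = 0 :=
    Matrix.det_eq_zero_of_row_eq_zero i (by simp)
  obtain ⟨c, hc, hac⟩ := Matrix.exists_mulVec_eq_zero_iff.mpr hdet
  refine hc (hv c ?_)
  have hk : ∀ k, rowCoord a v k * ∑ l, (a k l : ℝ) * (c l : ℝ) = 0 := by
    intro k
    by_cases hki : k = i
    · rw [hki, h0, zero_mul]
    · have := congrFun hac k
      simp only [Matrix.mulVec, dotProduct, Matrix.updateRow_ne hki, Pi.zero_apply] at this
      have h2 : ∑ l, (a k l : ℝ) * (c l : ℝ) = 0 := by exact_mod_cast this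
      rw [h2, mul_zero]
  calc ∑ l, (c l : ℝ) * v l = ∑ l, (c l : ℝ) * ∑ k, rowCoord a v k * (a k l : ℝ) := by
        simp_rw [sum_rowCoord ha]
    _ = ∑ k, rowCoord a v k * ∑ l, (a k l : ℝ) * (c l : ℝ) := by
        simp_rw [Finset.mul_sum]
        rw [Finset.sum_comm]
        exact Finset.sum_congr rfl fun _ _ => Finset.sum_congr rfl fun _ _ => by ring
    _ = 0 := Finset.sum_eq_zero fun k _ => hk k

/-- Lattice points of the simplicial cone spanned by the rows of `a` which remain in its interior
after an infinitesimal translation by `v`. -/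
def halfOpenCone (a : Fin m → Fin m → ℤ) (v : Fin m → ℝ) : Set (Fin m → ℤ) :=
  {e | ∀ i, LexPos (rowCoord a (fun k => (e k : ℝ)) i) (rowCoord a v i)}

theorem det_update_combination (a : Fin m → Fin m → ℤ) {i j : Fin m} (hij : i ≠ j)
    (α β : ℤ) : (Matrix.of (Function.update a i (α • a j + β • a i))).det = β * (Matrix.of a).det := by
  change ((Matrix.of a).updateRow i (α • Matrix.of a j + β • Matrix.of a i)).det = _
  rw [Matrix.det_updateRow_add, Matrix.det_updateRow_smul, Matrix.det_updateRow_smul,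
    Matrix.det_updateRow_eq_zero hij.symm, Matrix.updateRow_eq_self]
  simp

theorem rowCoord_update {a : Fin m → Fin m → ℤ} (ha : (Matrix.of a).det ≠ 0) {i j : Fin m}
    (hij : i ≠ j) (α : ℤ) {β : ℤ} (hβ : β ≠ 0) (x : Fin m → ℝ) :
    rowCoord (Function.update a i (α • a j + β • a i)) x =
      Function.update (Function.update (rowCoord a x) i (rowCoord a x i / β)) j
        (rowCoord a x j - α / β * rowCoord a x i) := by
  have hβ' : (β : ℝ) ≠ 0 := by exact_mod_cast hβ
  apply rowCoord_eq
  · rw [det_update_combination a hij]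
    exact mul_ne_zero hβ ha
  ext l
  rw [← sum_rowCoord ha x l]
  simp only [Matrix.vecMul, dotProduct, Matrix.map_apply]
  have hi := Finset.mem_univ i
  have hj : j ∈ Finset.univ.erase i := Finset.mem_erase.mpr ⟨hij.symm, Finset.mem_univ j⟩
  rw [← Finset.add_sum_erase _ _ hi, ← Finset.add_sum_erase _ _ hj,
    ← Finset.add_sum_erase _ _ hi, ← Finset.add_sum_erase _ _ hj]
  rw [← add_assoc, ← add_assoc]
  congr 1
  · simp [hij, hij.symm]
    field_simp
    ring
  · refine Finset.sum_congr rfl fun k hk => ?_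
    simp only [Finset.mem_erase] at hk
    simp [hk.1, hk.2.1]

theorem forall_lexPos_split {c d : Fin m → ℝ} {i j : Fin m} (hij : i ≠ j) {r : ℝ} (hr : 0 < r)
    {β : ℝ} (hβ : 0 < β) :
    (∀ k, LexPos (Function.update (Function.update c i (c i / β)) j (c j - r * c i) k)
        (Function.update (Function.update d i (d i / β)) j (d j - r * d i) k)) ↔
      (∀ k, LexPos (c k) (d k)) ∧ LexPos (c j - r * c i) (d j - r * d i) := by
  have hi : LexPos (c i / β) (d i / β) ↔ LexPos (c i) (d i) := by
    rw [div_eq_inv_mul, div_eq_inv_mul, LexPos.mul_iff (inv_pos.mpr hβ)]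
  constructor
  · intro h
    have h1 := h i
    have h2 := h j
    simp only [Function.update_self, Function.update_of_ne hij] at h1 h2
    rw [hi] at h1
    refine ⟨fun k => ?_, h2⟩
    by_cases hkj : k = j
    · subst hkj
      have := h2.add ((LexPos.mul_iff hr).mpr h1)
      simpa using this
    by_cases hki : k = i
    · subst hki; exact h1
    simpa [hkj, hki] using h k
  · rintro ⟨h, h2⟩ k
    by_cases hkj : k = j
    · subst hkj; simpa using h2
    by_cases hki : k = i
    · subst hki; simpa [hkj] using hi.mpr (h k)
    simpa [hkj, hki] using h k

theorem mem_halfOpenCone_update {a : Fin m → Fin m → ℤ} (ha : (Matrix.of a).det ≠ 0) {i j : Fin m}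
    (hij : i ≠ j) {α β : ℤ} (hα : 0 < α) (hβ : 0 < β) (v : Fin m → ℝ) (e : Fin m → ℤ) :
    e ∈ halfOpenCone (Function.update a i (α • a j + β • a i)) v ↔
      e ∈ halfOpenCone a v ∧
        LexPos (β * rowCoord a (fun k => (e k : ℝ)) j - α * rowCoord a (fun k => (e k : ℝ)) i)
          (β * rowCoord a v j - α * rowCoord a v i) := by
  have hα' : (0 : ℝ) < α := by exact_mod_cast hα
  have hβ' : (0 : ℝ) < β := by exact_mod_cast hβ
  simp only [halfOpenCone, Set.mem_ofPred_eq, rowCoord_update ha hij α hβ.ne']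
  rw [forall_lexPos_split hij (div_pos hα' hβ') hβ', ← LexPos.mul_iff hβ' (x := _ - _)]
  have h : ∀ x y : ℝ, β * (x - α / β * y) = β * x - α * y := fun x y => by field_simp
  rw [h, h]

theorem IsGeneric.combination_ne_zero {v : Fin m → ℝ} (hv : IsGeneric v)
    {a : Fin m → Fin m → ℤ} (ha : (Matrix.of a).det ≠ 0) {i j : Fin m} (hij : i ≠ j) (α : ℤ) {β : ℤ}
    (hβ : β ≠ 0) : β * rowCoord a v j - α * rowCoord a v i ≠ 0 := by
  have hβ' : (β : ℝ) ≠ 0 := by exact_mod_cast hβ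
  have hdet : (Matrix.of (Function.update a i (α • a j + β • a i))).det ≠ 0 := by
    rw [det_update_combination a hij]
    exact mul_ne_zero hβ ha
  have h := hv.rowCoord_ne_zero hdet j
  rw [rowCoord_update ha hij α hβ, Function.update_self] at h
  intro h0
  apply h
  field_simp
  linarith

theorem halfOpenCone_eq_union {a : Fin m → Fin m → ℤ} (ha : (Matrix.of a).det ≠ 0) {i j : Fin m}
    (hij : i ≠ j) {α β : ℤ} (hα : 0 < α) (hβ : 0 < β) {v : Fin m → ℝ} (hv : IsGeneric v) :
    halfOpenCone a v = halfOpenCone (Function.update a i (α • a j + β • a i)) v ∪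
      halfOpenCone (Function.update a j (α • a j + β • a i)) v ∧
    Disjoint (halfOpenCone (Function.update a i (α • a j + β • a i)) v)
      (halfOpenCone (Function.update a j (α • a j + β • a i)) v) := by
  have key : ∀ e, e ∈ halfOpenCone (Function.update a j (α • a j + β • a i)) v ↔
      e ∈ halfOpenCone a v ∧ ¬ e ∈ halfOpenCone (Function.update a i (α • a j + β • a i)) v := by
    intro e
    rw [mem_halfOpenCone_update ha hij hα hβ, add_comm (α • a j),
      mem_halfOpenCone_update ha hij.symm hβ hα]
    have := LexPos.neg_iff (x := β * rowCoord a (fun k => (e k : ℝ)) j -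
      α * rowCoord a (fun k => (e k : ℝ)) i) (hv.combination_ne_zero ha hij α hβ.ne')
    rw [neg_sub, neg_sub] at this
    tauto
  constructor
  · ext e
    rw [Set.mem_union, key]
    constructor
    · intro he
      by_cases h : e ∈ halfOpenCone (Function.update a i (α • a j + β • a i)) v
      · exact Or.inl h
      · exact Or.inr ⟨he, h⟩
    · rintro (h | h)
      · exact ((mem_halfOpenCone_update ha hij hα hβ v e).mp h).1
      · exact h.1
  · rw [Set.disjoint_left]
    intro e he he'
    exact ((key e).mp he').2 he

/-- The part of a half-open simplicial cone that is moved out of the cone by subtracting any one of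
the generators indexed by `J`. -/
def truncatedCone (a : Fin m → Fin m → ℤ) (v : Fin m → ℝ) (J : Finset (Fin m)) :
    Set (Fin m → ℤ) :=
  {e | ∀ i, LexPos (rowCoord a (fun k => (e k : ℝ)) i) (rowCoord a v i) ∧
    (i ∈ J → ¬ LexPos (rowCoord a (fun k => (e k : ℝ)) i - 1) (rowCoord a v i))}

theorem truncatedCone_empty (a : Fin m → Fin m → ℤ) (v : Fin m → ℝ) :
    truncatedCone a v ∅ = halfOpenCone a v := by
  ext e
  simp [truncatedCone, halfOpenCone]

theorem truncatedCone_subset (a : Fin m → Fin m → ℤ) (v : Fin m → ℝ) (J : Finset (Fin m)) :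
    truncatedCone a v J ⊆ halfOpenCone a v := fun _ h i => (h i).1

theorem rowCoord_sub_row {a : Fin m → Fin m → ℤ} (ha : (Matrix.of a).det ≠ 0) (e : Fin m → ℤ)
    (k : Fin m) : rowCoord a (fun l => ((e - a k) l : ℝ)) =
      rowCoord a (fun l => (e l : ℝ)) - Pi.single k 1 := by
  rw [← rowCoord_row ha k, ← rowCoord_sub]
  congr 1
  ext l
  simp

theorem sub_row_mem_truncatedCone {a : Fin m → Fin m → ℤ} (ha : (Matrix.of a).det ≠ 0) (v : Fin m → ℝ)
    {J : Finset (Fin m)} {k : Fin m} (hk : k ∉ J) (e : Fin m → ℤ) :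
    e - a k ∈ truncatedCone a v J ↔ e ∈ truncatedCone a v J ∧
      LexPos (rowCoord a (fun l => (e l : ℝ)) k - 1) (rowCoord a v k) := by
  have hmono : ∀ x y : ℝ, LexPos (x - 1) y → LexPos x y := fun x y h =>
    Or.inl (by linarith [h.nonneg])
  simp only [truncatedCone, Set.mem_ofPred_eq, rowCoord_sub_row ha]
  simp only [Pi.sub_apply]
  constructor
  · intro h
    have hk1 := (h k).1
    rw [Pi.single_eq_same] at hk1
    refine ⟨fun i => ?_, hk1⟩
    by_cases hik : i = k
    · subst hik
      exact ⟨hmono _ _ hk1, fun hi => absurd hi hk⟩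
    · simpa [hik] using h i
  · rintro ⟨h, h1⟩ i
    by_cases hik : i = k
    · subst hik
      exact ⟨by simpa using h1, fun hi => absurd hi hk⟩
    · simpa [hik] using h i

theorem mem_truncatedCone_insert {a : Fin m → Fin m → ℤ} (ha : (Matrix.of a).det ≠ 0) (v : Fin m → ℝ)
    {J : Finset (Fin m)} {k : Fin m} (hk : k ∉ J) (e : Fin m → ℤ) :
    e ∈ truncatedCone a v (insert k J) ↔
      e ∈ truncatedCone a v J ∧ e - a k ∉ truncatedCone a v J := by
  rw [sub_row_mem_truncatedCone ha v hk]
  simp only [truncatedCone, Set.mem_ofPred_eq, Finset.mem_insert]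
  constructor
  · intro h
    exact ⟨fun i => ⟨(h i).1, fun hi => (h i).2 (Or.inr hi)⟩, fun h' => (h k).2 (Or.inl rfl) h'.2⟩
  · rintro ⟨h, h'⟩ i
    refine ⟨(h i).1, ?_⟩
    rintro (rfl | hi)
    · exact fun h2 => h' ⟨h, h2⟩
    · exact (h i).2 hi

/-- Multiplying a series over a half-open simplicial cone that is geometric along every generator
by the factors `1 - y k` restricts the summation to a truncated cone. -/
theorem prod_mul_tsum_halfOpenCone {a : Fin m → Fin m → ℤ} (ha : (Matrix.of a).det ≠ 0)
    (v : Fin m → ℝ) (g : (Fin m → ℤ) → ℂ) (y : Fin m → ℂ)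
    (hs : Summable ((halfOpenCone a v).indicator g))
    (hg : ∀ e ∈ halfOpenCone a v, ∀ k, g (e + a k) = y k * g e) (J : Finset (Fin m)) :
    (∏ k ∈ J, (1 - y k)) * ∑' e, (halfOpenCone a v).indicator g e =
      ∑' e, (truncatedCone a v J).indicator g e := by
  induction J using Finset.induction_on with
  | empty => simp [truncatedCone_empty]
  | insert k J hk ih =>
    rw [Finset.prod_insert hk, mul_assoc, ih, sub_mul, one_mul]
    have hsJ : Summable ((truncatedCone a v J).indicator g) := by
      have := hs.indicator (truncatedCone a v J)
      rwa [Set.indicator_indicator, Set.inter_eq_left.mpr (truncatedCone_subset a v J)] at this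
    set T : Set (Fin m → ℤ) := {e | e - a k ∈ truncatedCone a v J} with hT
    have hshift : (fun e => y k * (truncatedCone a v J).indicator g e) =
        fun e => T.indicator g (Equiv.addRight (a k) e) := by
      ext e
      by_cases he : e ∈ truncatedCone a v J
      · have : e + a k ∈ T := by simpa [hT] using he
        simp [he, this, hg e (truncatedCone_subset a v J he) k]
      · have : e + a k ∉ T := by simpa [hT] using he
        simp [he, this]
    have hsT : Summable (T.indicator g) := by
      have := hsJ.mul_left (y k)
      rw [hshift] at this
      exact (Equiv.summable_iff (Equiv.addRight (a k))).mp this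
    rw [← tsum_mul_left, hshift, Equiv.tsum_eq (Equiv.addRight (a k)) (T.indicator g),
      ← hsJ.tsum_sub hsT]
    congr 1
    ext e
    have h1 := mem_truncatedCone_insert ha v hk e
    have h2 : e ∈ T → e ∈ truncatedCone a v J := fun h =>
      ((sub_row_mem_truncatedCone ha v hk e).mp h).1
    change e ∈ _ ↔ e ∈ _ ∧ e ∉ T at h1
    by_cases hJ : e ∈ truncatedCone a v J <;> by_cases hTe : e ∈ T <;> simp_all

theorem finite_truncatedCone {a : Fin m → Fin m → ℤ} (ha : (Matrix.of a).det ≠ 0)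
    (hnonneg : ∀ i k, 0 ≤ a i k) (v : Fin m → ℝ) :
    (truncatedCone a v Finset.univ).Finite := by
  refine (Set.finite_Icc (0 : Fin m → ℤ) (∑ i, a i)).subset fun e he => ?_
  have h01 : ∀ i, 0 ≤ rowCoord a (fun k => (e k : ℝ)) i ∧
      rowCoord a (fun k => (e k : ℝ)) i ≤ 1 := fun i => by
    refine ⟨(he i).1.nonneg, ?_⟩
    by_contra h
    exact (he i).2 (Finset.mem_univ i) (Or.inl (by linarith))
  have ha' : ∀ i k, (0 : ℝ) ≤ a i k := fun i k => by exact_mod_cast hnonneg i k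
  refine ⟨fun k => ?_, fun k => ?_⟩
  · have : (0 : ℝ) ≤ e k := by
      rw [← sum_rowCoord ha (fun k => (e k : ℝ)) k]
      exact Finset.sum_nonneg fun i _ => mul_nonneg (h01 i).1 (ha' i k)
    exact_mod_cast this
  · have : (e k : ℝ) ≤ ∑ i, (a i k : ℝ) := by
      rw [← sum_rowCoord ha (fun k => (e k : ℝ)) k]
      exact Finset.sum_le_sum fun i _ => mul_le_of_le_one_left (ha' i k) (h01 i).2
    rw [Finset.sum_apply]
    exact_mod_cast this

theorem nonneg_of_mem_halfOpenCone {a : Fin m → Fin m → ℤ} (ha : (Matrix.of a).det ≠ 0)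
    (hnonneg : ∀ i k, 0 ≤ a i k) {v : Fin m → ℝ} {e : Fin m → ℤ} (he : e ∈ halfOpenCone a v)
    (k : Fin m) : 0 ≤ e k := by
  have : (0 : ℝ) ≤ e k := by
    rw [← sum_rowCoord ha (fun k => (e k : ℝ)) k]
    exact Finset.sum_nonneg fun i _ => mul_nonneg (he i).nonneg (by exact_mod_cast hnonneg i k)
  exact_mod_cast this

/-- The point reflection of the fundamental parallelepiped exchanges its two half-open versions. -/
theorem sum_sub_mem_truncatedCone {a : Fin m → Fin m → ℤ} (ha : (Matrix.of a).det ≠ 0) {v : Fin m → ℝ}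
    (hv : IsGeneric v) {e : Fin m → ℤ} (he : e ∈ truncatedCone a v Finset.univ) :
    ∑ i, a i - e ∈ truncatedCone a (-v) Finset.univ := by
  have hc : rowCoord a (fun k => ((∑ i, a i - e) k : ℝ)) =
      1 - rowCoord a (fun k => (e k : ℝ)) := by
    rw [← rowCoord_sum_rows ha, ← rowCoord_sub]
    congr 1
    ext l
    simp
  intro i
  have h0 := hv.rowCoord_ne_zero ha i
  rw [hc, rowCoord_neg]
  obtain ⟨h1, h2⟩ := he i
  simp only [Pi.sub_apply, Pi.one_apply, Pi.neg_apply]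
  constructor
  · rw [← neg_sub, LexPos.neg_iff h0]
    exact h2 (Finset.mem_univ i)
  · intro _
    rw [sub_sub_cancel_left, LexPos.neg_iff h0, not_not]
    exact h1

/-- The monomial `x ^ (c ⬝ e) * y ^ (d ⬝ e)`. -/
def latticeMonomial {F : Type*} [Field F] (x y : F) (c d e : Fin m → ℤ) : F :=
  x ^ zdot c e * y ^ zdot d e

section latticeMonomial

variable {F : Type*} [Field F] {x y : F}

theorem latticeMonomial_add (hx : x ≠ 0) (hy : y ≠ 0) (c d e e' : Fin m → ℤ) :
    latticeMonomial x y c d (e + e') =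
      latticeMonomial x y c d e * latticeMonomial x y c d e' := by
  simp only [latticeMonomial, zdot_eq_dotProduct, dotProduct_add, zpow_add₀ hx, zpow_add₀ hy]
  ring

theorem latticeMonomial_zero (c d : Fin m → ℤ) : latticeMonomial x y c d 0 = 1 := by
  simp [latticeMonomial, zdot]

theorem latticeMonomial_ne_zero (hx : x ≠ 0) (hy : y ≠ 0) (c d e : Fin m → ℤ) :
    latticeMonomial x y c d e ≠ 0 := mul_ne_zero (zpow_ne_zero _ hx) (zpow_ne_zero _ hy)

theorem latticeMonomial_inv (c d e : Fin m → ℤ) :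
    latticeMonomial x⁻¹ y⁻¹ c d e = (latticeMonomial x y c d e)⁻¹ := by
  simp [latticeMonomial, mul_comm]

theorem latticeMonomial_sum (hx : x ≠ 0) (hy : y ≠ 0) (c d : Fin m → ℤ) {ι : Type*}
    (s : Finset ι) (f : ι → Fin m → ℤ) :
    latticeMonomial x y c d (∑ i ∈ s, f i) = ∏ i ∈ s, latticeMonomial x y c d (f i) := by
  classical
  induction s using Finset.induction_on with
  | empty => simp [latticeMonomial_zero]
  | insert i s hi ih => rw [Finset.sum_insert hi, Finset.prod_insert hi,
      latticeMonomial_add hx hy, ih]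

/-- Reciprocity for the numerators of the generating functions of half-open parallelepipeds. -/
theorem sum_inv_latticeMonomial_mul_prod (hx : x ≠ 0) (hy : y ≠ 0) (c d : Fin m → ℤ)
    {a : Fin m → Fin m → ℤ} (ha : (Matrix.of a).det ≠ 0) {v : Fin m → ℝ} (hv : IsGeneric v)
    (hv' : IsGeneric (-v)) {S S' : Finset (Fin m → ℤ)}
    (hS : (S : Set (Fin m → ℤ)) = truncatedCone a v Finset.univ)
    (hS' : (S' : Set (Fin m → ℤ)) = truncatedCone a (-v) Finset.univ) :
    (∑ e ∈ S, latticeMonomial x⁻¹ y⁻¹ c d e) * ∏ i, (1 - latticeMonomial x y c d (a i)) =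
      (-1) ^ m * (∑ e ∈ S', latticeMonomial x y c d e) *
        ∏ i, (1 - latticeMonomial x⁻¹ y⁻¹ c d (a i)) := by
  have hprod : ∏ i, (1 - latticeMonomial x y c d (a i)) =
      (-1) ^ m * latticeMonomial x y c d (∑ i, a i) *
        ∏ i, (1 - latticeMonomial x⁻¹ y⁻¹ c d (a i)) := by
    have hm : (-1 : F) ^ m = ∏ _i : Fin m, (-1 : F) := by simp
    rw [latticeMonomial_sum hx hy, hm, ← Finset.prod_mul_distrib, ← Finset.prod_mul_distrib]
    refine Finset.prod_congr rfl fun i _ => ?_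
    have := latticeMonomial_ne_zero hx hy c d (a i)
    rw [latticeMonomial_inv]
    field_simp
    ring
  have hsum : latticeMonomial x y c d (∑ i, a i) * ∑ e ∈ S, latticeMonomial x⁻¹ y⁻¹ c d e =
      ∑ e ∈ S', latticeMonomial x y c d e := by
    rw [Finset.mul_sum]
    refine Finset.sum_nbij' (fun e => ∑ i, a i - e) (fun e => ∑ i, a i - e) ?_ ?_ ?_ ?_ ?_
    · intro e he
      rw [← Finset.mem_coe, hS']
      exact sum_sub_mem_truncatedCone ha hv (hS ▸ Finset.mem_coe.mpr he)
    · intro e he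
      rw [← Finset.mem_coe, hS]
      have := sum_sub_mem_truncatedCone ha hv' (hS' ▸ Finset.mem_coe.mpr he)
      rwa [neg_neg] at this
    · intro e _; simp
    · intro e _; simp
    · intro e _
      rw [latticeMonomial_inv, mul_inv_eq_iff_eq_mul₀ (latticeMonomial_ne_zero hx hy _ _ _),
        ← latticeMonomial_add hx hy, sub_add_cancel]
  rw [hprod, ← hsum]
  ring

end latticeMonomial

section ConePolynomials

open MvPolynomial

/-- The denominator of the generating function of a half-open simplicial cone, with exponents of the
first variable shifted by `N` per factor. -/
noncomputable def coneDenominator (N : ℕ) (c d : Fin m → ℤ) (a : Fin m → Fin m → ℤ) :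
    MvPolynomial (Fin 2) ℚ :=
  X 0 ^ N * ∏ i, (X 0 ^ N - X 0 ^ (N + zdot c (a i)).toNat * X 1 ^ (zdot d (a i)).toNat)

/-- The numerator of the generating function of a half-open simplicial cone whose fundamental
parallelepiped has the lattice points `S`. -/
noncomputable def coneNumerator (N : ℕ) (c d : Fin m → ℤ) (S : Finset (Fin m → ℤ)) :
    MvPolynomial (Fin 2) ℚ :=
  (X 0 ^ N) ^ m * ∑ e ∈ S, X 0 ^ (N + zdot c e).toNat * X 1 ^ (zdot d e).toNat

variable {F : Type*} [Field F]

theorem pow_toNat_mul_pow_toNat {x y : F} (hx : x ≠ 0) {N : ℕ} {c d e : Fin m → ℤ}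
    (hc : 0 ≤ N + zdot c e) (hd : 0 ≤ zdot d e) :
    x ^ (N + zdot c e).toNat * y ^ (zdot d e).toNat = x ^ N * latticeMonomial x y c d e := by
  rw [← zpow_natCast, ← zpow_natCast y, Int.toNat_of_nonneg hc, Int.toNat_of_nonneg hd,
    zpow_add₀ hx, zpow_natCast, latticeMonomial, mul_assoc]

variable [Algebra ℚ F]

theorem aeval_coneDenominator {z : Fin 2 → F} (hz : z 0 ≠ 0) {N : ℕ} {c d : Fin m → ℤ}
    {a : Fin m → Fin m → ℤ} (hc : ∀ i, 0 ≤ N + zdot c (a i)) (hd : ∀ i, 0 ≤ zdot d (a i)) :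
    aeval z (coneDenominator N c d a) =
      (z 0 ^ N) ^ (m + 1) * ∏ i, (1 - latticeMonomial (z 0) (z 1) c d (a i)) := by
  simp only [coneDenominator, map_mul, map_prod, map_sub, map_pow, aeval_X]
  simp_rw [fun i => pow_toNat_mul_pow_toNat (y := z 1) hz (hc i) (hd i), ← mul_one_sub]
  rw [Finset.prod_mul_distrib, Finset.prod_const, Finset.card_univ, Fintype.card_fin]
  ring

theorem aeval_coneNumerator {z : Fin 2 → F} (hz : z 0 ≠ 0) {N : ℕ} {c d : Fin m → ℤ}
    {S : Finset (Fin m → ℤ)} (hc : ∀ e ∈ S, 0 ≤ N + zdot c e) (hd : ∀ e ∈ S, 0 ≤ zdot d e) :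
    aeval z (coneNumerator N c d S) =
      (z 0 ^ N) ^ (m + 1) * ∑ e ∈ S, latticeMonomial (z 0) (z 1) c d e := by
  simp only [coneNumerator, map_mul, map_sum, map_pow, aeval_X]
  rw [Finset.sum_congr rfl fun e he => pow_toNat_mul_pow_toNat (y := z 1) hz (hc e he) (hd e he),
    ← Finset.mul_sum]
  ring

theorem coneDenominator_ne_zero {N : ℕ} {c d : Fin m → ℤ}
    {a : Fin m → Fin m → ℤ} (hc : ∀ i, 0 ≤ N + zdot c (a i)) (hd : ∀ i, 0 < zdot d (a i)) :
    coneDenominator N c d a ≠ 0 := by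
  intro h
  have h1 := aeval_coneDenominator (F := ℚ) (z := ![1, 2]) (by simp) hc fun i => (hd i).le
  rw [h, map_zero] at h1
  simp only [latticeMonomial, Matrix.cons_val_zero, Matrix.cons_val_one, one_pow, one_zpow,
    one_mul] at h1
  obtain ⟨i, -, hi⟩ := Finset.prod_eq_zero_iff.mp h1.symm
  have := one_lt_zpow₀ (one_lt_two (α := ℚ)) (hd i)
  linarith

end ConePolynomials

/-- The term `q ^ (φ e - (d ⬝ e) * s)` of a zeta series. -/
noncomputable def zetaTerm (φ : (Fin m → ℤ) → ℤ) (d : Fin m → ℤ) (q : ℝ) (s : ℂ)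
    (e : Fin m → ℤ) : ℂ :=
  (q : ℂ) ^ (((φ e : ℤ) : ℂ) - ((zdot d e : ℤ) : ℂ) * s)

theorem zetaTerm_eq_latticeMonomial {φ : (Fin m → ℤ) → ℤ} {c d e : Fin m → ℤ}
    (h : φ e = zdot c e) {q : ℝ} (hq : 0 < q) (s : ℂ) :
    zetaTerm φ d q s e = latticeMonomial (q : ℂ) ((q : ℂ) ^ (-s)) c d e := by
  have hq' : (q : ℂ) ≠ 0 := by exact_mod_cast hq.ne'
  rw [zetaTerm, latticeMonomial, h, sub_eq_add_neg, Complex.cpow_add _ _ hq', Complex.cpow_intCast,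
    ← Complex.cpow_int_mul]
  congr 2
  ring

theorem Summable.indicator_of_subset {α : Type*} {S T : Set α} {f : α → ℂ}
    (h : Summable (S.indicator f)) (hTS : T ⊆ S) : Summable (T.indicator f) := by
  have := h.indicator T
  rwa [Set.indicator_indicator, Set.inter_eq_left.mpr hTS] at this

/-- The families of series over the sets `X I` of lattice points are given by rational functions with
a common denominator that satisfy the reciprocity law exchanging `I` with its complement. -/
def HasReciprocity (φ : (Fin m → ℤ) → ℤ) (d : Fin m → ℤ)
    (X : Finset (Fin m) → Set (Fin m → ℤ)) : Prop :=
  ∃ (Q : MvPolynomial (Fin 2) ℚ) (P : Finset (Fin m) → MvPolynomial (Fin 2) ℚ), Q ≠ 0 ∧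
    (∀ (I : Finset (Fin m)) (q : ℝ) (s : ℂ), 1 < q →
      Summable ({e : Fin m → ℤ | ∀ i, 0 ≤ e i}.indicator (zetaTerm φ d q s)) →
      MvPolynomial.aeval (fun j : Fin 2 => if j = 0 then (q : ℂ) else (q : ℂ) ^ (-s)) Q *
          ∑' e, (X I).indicator (zetaTerm φ d q s) e =
        MvPolynomial.aeval (fun j : Fin 2 => if j = 0 then (q : ℂ) else (q : ℂ) ^ (-s)) (P I)) ∧
    ∀ I : Finset (Fin m),
      MvPolynomial.aeval (fun j : Fin 2 => (algebraMap (MvPolynomial (Fin 2) ℚ)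
          (FractionRing (MvPolynomial (Fin 2) ℚ)) (MvPolynomial.X j))⁻¹) (P I) *
        algebraMap (MvPolynomial (Fin 2) ℚ) (FractionRing (MvPolynomial (Fin 2) ℚ)) Q =
      (-1) ^ m * algebraMap (MvPolynomial (Fin 2) ℚ) (FractionRing (MvPolynomial (Fin 2) ℚ))
          (P (Finset.univ \ I)) *
        MvPolynomial.aeval (fun j : Fin 2 => (algebraMap (MvPolynomial (Fin 2) ℚ)
          (FractionRing (MvPolynomial (Fin 2) ℚ)) (MvPolynomial.X j))⁻¹) Q

theorem HasReciprocity.union {φ : (Fin m → ℤ) → ℤ} {d : Fin m → ℤ}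
    {X Y : Finset (Fin m) → Set (Fin m → ℤ)} (hX : HasReciprocity φ d X)
    (hY : HasReciprocity φ d Y) (hX0 : ∀ I, ∀ e ∈ X I, ∀ i, 0 ≤ e i)
    (hY0 : ∀ I, ∀ e ∈ Y I, ∀ i, 0 ≤ e i) (hdisj : ∀ I, Disjoint (X I) (Y I)) :
    HasReciprocity φ d (fun I => X I ∪ Y I) := by
  obtain ⟨Q, P, hQ, hsum, hrec⟩ := hX
  obtain ⟨Q', P', hQ', hsum', hrec'⟩ := hY
  refine ⟨Q * Q', fun I => P I * Q' + P' I * Q, mul_ne_zero hQ hQ', fun I q s hq hs => ?_,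
    fun I => ?_⟩
  · have hsX : Summable ((X I).indicator (zetaTerm φ d q s)) :=
      hs.indicator_of_subset fun e he => hX0 I e he
    have hsY : Summable ((Y I).indicator (zetaTerm φ d q s)) :=
      hs.indicator_of_subset fun e he => hY0 I e he
    rw [Set.indicator_union_of_disjoint (hdisj I), hsX.tsum_add hsY, map_add, map_mul, map_mul,
      map_mul, ← hsum I q s hq hs, ← hsum' I q s hq hs]
    ring
  · simp only [map_add, map_mul]
    linear_combination (algebraMap (MvPolynomial (Fin 2) ℚ)
        (FractionRing (MvPolynomial (Fin 2) ℚ)) Q') * MvPolynomial.aeval (fun j : Fin 2 =>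
        (algebraMap (MvPolynomial (Fin 2) ℚ) (FractionRing (MvPolynomial (Fin 2) ℚ))
          (MvPolynomial.X j))⁻¹) Q' * hrec I +
      (algebraMap (MvPolynomial (Fin 2) ℚ)
        (FractionRing (MvPolynomial (Fin 2) ℚ)) Q) * MvPolynomial.aeval (fun j : Fin 2 =>
        (algebraMap (MvPolynomial (Fin 2) ℚ) (FractionRing (MvPolynomial (Fin 2) ℚ))
          (MvPolynomial.X j))⁻¹) Q * hrec' I

theorem row_ne_zero {a : Fin m → Fin m → ℤ} (ha : (Matrix.of a).det ≠ 0) (i : Fin m) :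
    a i ≠ 0 := fun h =>
  ha (Matrix.det_eq_zero_of_row_eq_zero i fun j => congrFun h j)

theorem hasReciprocity_halfOpenCone {φ : (Fin m → ℤ) → ℤ} {c d : Fin m → ℤ}
    (hd : ∀ e : Fin m → ℤ, (∀ i, 0 ≤ e i) → e ≠ 0 → 0 < zdot d e)
    {a : Fin m → Fin m → ℤ} (ha : (Matrix.of a).det ≠ 0) (hnonneg : ∀ i k, 0 ≤ a i k)
    {v : Finset (Fin m) → Fin m → ℝ} (hv : ∀ I, IsGeneric (v I))
    (hcompl : ∀ I, v (Finset.univ \ I) = -v I)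
    (hφ : ∀ e : Fin m → ℤ, (∀ i, 0 ≤ rowCoord a (fun k => (e k : ℝ)) i) → φ e = zdot c e) :
    HasReciprocity φ d (fun I => halfOpenCone a (v I)) := by
  have hd0 : ∀ e : Fin m → ℤ, (∀ i, 0 ≤ e i) → 0 ≤ zdot d e := fun e he => by
    rcases eq_or_ne e 0 with rfl | h
    · simp [zdot]
    · exact (hd e he h).le
  choose S hS using fun I => (finite_truncatedCone ha hnonneg (v I)).exists_finset_coe
  have hSmem : ∀ I, ∀ e ∈ S I, e ∈ truncatedCone a (v I) Finset.univ := fun I e he =>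
    hS I ▸ Finset.mem_coe.mpr he
  obtain ⟨N, hN⟩ : ∃ N : ℕ, ∀ e ∈ (Finset.univ.biUnion S) ∪ Finset.univ.image a,
      0 ≤ N + zdot c e := by
    refine ⟨∑ e ∈ (Finset.univ.biUnion S) ∪ Finset.univ.image a, (zdot c e).natAbs,
      fun e he => ?_⟩
    have := Finset.single_le_sum (f := fun e => (zdot c e).natAbs) (fun _ _ => Nat.zero_le _) he
    omega
  have hNa : ∀ i, 0 ≤ N + zdot c (a i) := fun i => hN _ (by simp)
  have hNS : ∀ I, ∀ e ∈ S I, 0 ≤ N + zdot c e := fun I e he => hN _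
    (Finset.mem_union_left _ (Finset.mem_biUnion.mpr ⟨I, Finset.mem_univ _, he⟩))
  have hda : ∀ i, 0 < zdot d (a i) := fun i => hd _ (hnonneg i) (row_ne_zero ha i)
  have hdS : ∀ I, ∀ e ∈ S I, 0 ≤ zdot d e := fun I e he => hd0 e
    (nonneg_of_mem_halfOpenCone ha hnonneg (truncatedCone_subset _ _ _ (hSmem I e he)))
  refine ⟨coneDenominator N c d a, fun I => coneNumerator N c d (S I),
    coneDenominator_ne_zero hNa hda, fun I q s hq hs => ?_, fun I => ?_⟩
  · have hq0 : 0 < q := by linarith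
    have hq' : (q : ℂ) ≠ 0 := by exact_mod_cast hq0.ne'
    have ht : (q : ℂ) ^ (-s) ≠ 0 := by simp [Complex.cpow_eq_zero_iff, hq']
    rw [aeval_coneDenominator (by simpa using hq') hNa fun i => (hda i).le,
      aeval_coneNumerator (by simpa using hq') (hNS I) (hdS I)]
    simp only [if_true, one_ne_zero, if_false]
    have hterm : ∀ e ∈ halfOpenCone a (v I), zetaTerm φ d q s e =
        latticeMonomial (q : ℂ) ((q : ℂ) ^ (-s)) c d e := fun e he =>
      zetaTerm_eq_latticeMonomial (hφ e fun i => (he i).nonneg) hq0 s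
    have hind : ∀ T ⊆ halfOpenCone a (v I), T.indicator (zetaTerm φ d q s) =
        T.indicator (latticeMonomial (q : ℂ) ((q : ℂ) ^ (-s)) c d) := fun T hT =>
      Set.indicator_congr fun e he => hterm e (hT he)
    have hsX : Summable ((halfOpenCone a (v I)).indicator (zetaTerm φ d q s)) :=
      hs.indicator_of_subset fun e he => nonneg_of_mem_halfOpenCone ha hnonneg he
    rw [hind _ subset_rfl] at hsX ⊢
    rw [mul_assoc, prod_mul_tsum_halfOpenCone ha (v I) _ _ hsX
      (fun e _ k => by rw [latticeMonomial_add hq' ht, mul_comm]), ← hS I]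
    rw [tsum_eq_sum (s := S I) (fun e he => by simp [he])]
    congr 1
    exact Finset.sum_congr rfl fun e he => by simp [he]
  · set ι := algebraMap (MvPolynomial (Fin 2) ℚ) (FractionRing (MvPolynomial (Fin 2) ℚ)) with hι
    have hX : ∀ j, ι (MvPolynomial.X j) ≠ 0 := fun j => by
      rw [hι, Ne, FaithfulSMul.algebraMap_eq_zero_iff]
      exact MvPolynomial.X_ne_zero j
    have hιa : ∀ p, ι p = MvPolynomial.aeval (fun j => ι (MvPolynomial.X j)) p := fun p => by
      have h := MvPolynomial.aeval_algebraMap_apply (FractionRing (MvPolynomial (Fin 2) ℚ))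
        (MvPolynomial.X : Fin 2 → MvPolynomial (Fin 2) ℚ) p
      rw [MvPolynomial.aeval_X_left_apply] at h
      exact h.symm
    rw [hιa, hιa (coneNumerator _ _ _ _),
      aeval_coneNumerator (z := fun j => (ι (MvPolynomial.X j))⁻¹) (inv_ne_zero (hX 0)) (hNS I) (hdS I),
      aeval_coneNumerator (hX 0) (hNS _) (hdS _),
      aeval_coneDenominator (z := fun j => (ι (MvPolynomial.X j))⁻¹) (inv_ne_zero (hX 0)) hNa
        fun i => (hda i).le,
      aeval_coneDenominator (hX 0) hNa fun i => (hda i).le]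
    have h := sum_inv_latticeMonomial_mul_prod (hX 0) (hX 1) c d ha (hv I)
      (hcompl I ▸ hv (Finset.univ \ I)) (hS I) ((hS (Finset.univ \ I)).trans (by rw [hcompl]))
    linear_combination ((ι (MvPolynomial.X 0))⁻¹ ^ N) ^ (m + 1) *
      (ι (MvPolynomial.X 0) ^ N) ^ (m + 1) * h

/-- A vector configuration lies in a single closed half-space of the form `w`. -/
def IsOneSided (w : Fin m → ℤ) (a : Fin m → Fin m → ℤ) : Prop :=
  (∀ i, 0 ≤ zdot w (a i)) ∨ ∀ i, zdot w (a i) ≤ 0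

theorem zdot_add (w x y : Fin m → ℤ) : zdot w (x + y) = zdot w x + zdot w y := by
  simp only [zdot_eq_dotProduct, dotProduct_add]

theorem zdot_smul (w : Fin m → ℤ) (n : ℤ) (x : Fin m → ℤ) : zdot w (n • x) = n * zdot w x := by
  simp only [zdot_eq_dotProduct, dotProduct_smul, smul_eq_mul]

theorem IsOneSided.update {w : Fin m → ℤ} {a : Fin m → Fin m → ℤ} (h : IsOneSided w a)
    (i : Fin m) {b : Fin m → ℤ} {α β : ℤ} (hα : 0 ≤ α) (hβ : 0 ≤ β) {j k : Fin m}
    (hb : b = α • a j + β • a k) : IsOneSided w (Function.update a i b) := by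
  have hwb : zdot w b = α * zdot w (a j) + β * zdot w (a k) := by
    rw [hb, zdot_add, zdot_smul, zdot_smul]
  refine h.imp (fun h l => ?_) (fun h l => ?_) <;> rcases eq_or_ne l i with rfl | hl
  · rw [Function.update_self, hwb]
    exact add_nonneg (mul_nonneg hα (h j)) (mul_nonneg hβ (h k))
  · rw [Function.update_of_ne hl]
    exact h l
  · rw [Function.update_self, hwb]
    exact add_nonpos (mul_nonpos_of_nonneg_of_nonpos hα (h j))
      (mul_nonpos_of_nonneg_of_nonpos hβ (h k))
  · rw [Function.update_of_ne hl]
    exact h l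

theorem cast_zdot_eq_sum_rowCoord {a : Fin m → Fin m → ℤ} (ha : (Matrix.of a).det ≠ 0)
    (w e : Fin m → ℤ) :
    (zdot w e : ℝ) = ∑ i, rowCoord a (fun k => (e k : ℝ)) i * (zdot w (a i) : ℝ) := by
  simp only [zdot, Int.cast_sum, Int.cast_mul, Finset.mul_sum]
  rw [Finset.sum_comm]
  refine Finset.sum_congr rfl fun k _ => ?_
  rw [← sum_rowCoord ha (fun k => (e k : ℝ)) k, Finset.mul_sum]
  exact Finset.sum_congr rfl fun i _ => by ring

theorem zdot_sum_rows (w : Fin m → ℤ) (a : Fin m → Fin m → ℤ) :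
    zdot w (∑ i, a i) = ∑ i, zdot w (a i) := by
  simp only [zdot_eq_dotProduct, dotProduct_sum]

/-- A simplicial cone not crossed by any of the hyperplanes lies in the closure of the cell of the
sum of its generators. -/
theorem zInClosure_sum_rows {κ : ℕ} {w : Fin κ → Fin m → ℤ} {a : Fin m → Fin m → ℤ}
    (ha : (Matrix.of a).det ≠ 0) (hnonneg : ∀ i k, 0 ≤ a i k) (hw : ∀ j, IsOneSided (w j) a)
    {e : Fin m → ℤ} (he : ∀ i, 0 ≤ rowCoord a (fun k => (e k : ℝ)) i) :
    zInClosure w (∑ i, a i) e := by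
  refine ⟨fun k hk => ?_, fun j => ?_⟩
  · rw [Finset.sum_apply] at hk
    have h0 := (Finset.sum_eq_zero_iff_of_nonneg fun i _ => hnonneg i k).mp hk
    have : (e k : ℝ) = 0 := by
      rw [← sum_rowCoord ha (fun k => (e k : ℝ)) k]
      exact Finset.sum_eq_zero fun i hi => by rw [h0 i hi, Int.cast_zero, mul_zero]
    exact_mod_cast this
  · rw [zdot_sum_rows, ← Int.cast_nonneg_iff (R := ℝ), ← Int.cast_nonpos (R := ℝ),
      ← Int.cast_eq_zero (α := ℝ) (n := zdot (w j) e), cast_zdot_eq_sum_rowCoord ha]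
    rcases hw j with h | h
    · have hnn : ∀ i, (0 : ℝ) ≤ zdot (w j) (a i) := fun i => by exact_mod_cast h i
      refine ⟨fun h0 => ?_, fun _ => Finset.sum_nonneg fun i _ => mul_nonneg (he i) (hnn i),
        fun h0 => absurd (Finset.sum_nonneg fun i _ => h i) h0.not_ge⟩
      have := (Finset.sum_eq_zero_iff_of_nonneg fun i _ => h i).mp h0
      exact Finset.sum_eq_zero fun i hi => by rw [this i hi, Int.cast_zero, mul_zero]
    · have hnp : ∀ i, (zdot (w j) (a i) : ℝ) ≤ 0 := fun i => by exact_mod_cast h i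
      refine ⟨fun h0 => ?_, fun h0 => absurd (Finset.sum_nonpos fun i _ => h i) h0.not_ge,
        fun _ => Finset.sum_nonpos fun i _ => mul_nonpos_of_nonneg_of_nonpos (he i) (hnp i)⟩
      have := (Finset.sum_eq_zero_iff_of_nonpos fun i _ => h i).mp h0
      exact Finset.sum_eq_zero fun i hi => by rw [this i hi, Int.cast_zero, mul_zero]

/-- Reciprocity extends from the simplicial cones that are not crossed by finitely many given
hyperplanes to all simplicial cones in the orthant, by repeated subdivision of edges. -/
theorem hasReciprocity_of_forall_isOneSided {φ : (Fin m → ℤ) → ℤ} {d : Fin m → ℤ}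
    {κ : ℕ} (w : Fin κ → Fin m → ℤ) {v : Finset (Fin m) → Fin m → ℝ} (hv : ∀ I, IsGeneric (v I))
    (h : ∀ a : Fin m → Fin m → ℤ, (Matrix.of a).det ≠ 0 → (∀ i k, 0 ≤ a i k) →
      (∀ j, IsOneSided (w j) a) → HasReciprocity φ d (fun I => halfOpenCone a (v I)))
    (J : Finset (Fin κ)) (a : Fin m → Fin m → ℤ) (ha : (Matrix.of a).det ≠ 0)
    (hnonneg : ∀ i k, 0 ≤ a i k) (hJ : ∀ j ∉ J, IsOneSided (w j) a) :
    HasReciprocity φ d (fun I => halfOpenCone a (v I)) := by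
  induction J using Finset.induction_on generalizing a with
  | empty => exact h a ha hnonneg fun j => hJ j (Finset.notMem_empty j)
  | insert j₀ J hj₀ ih =>
    induction hn : (Finset.univ.filter fun i => zdot (w j₀) (a i) ≠ 0).card using
      Nat.strong_induction_on generalizing a with
    | _ n ihn =>
      by_cases hone : IsOneSided (w j₀) a
      · refine ih a ha hnonneg fun j hj => ?_
        by_cases hjj : j = j₀
        · exact hjj ▸ hone
        · exact hJ j (by simp [hjj, hj])
      · simp only [IsOneSided, not_or, not_forall, not_le] at hone
        obtain ⟨⟨i, hi⟩, ⟨k, hk⟩⟩ := hone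
        have hik : i ≠ k := by rintro rfl; omega
        set α := -zdot (w j₀) (a i) with hα
        set β := zdot (w j₀) (a k) with hβ
        have hα0 : 0 < α := by omega
        have hβ0 : 0 < β := hk
        set b := α • a k + β • a i with hb
        have hwb : zdot (w j₀) b = 0 := by
          rw [hb, zdot_add, zdot_smul, zdot_smul, hα, hβ]
          ring
        have hb0 : ∀ l, 0 ≤ b l := fun l => by
          simp only [hb, Pi.add_apply, Pi.smul_apply, smul_eq_mul]
          exact add_nonneg (mul_nonneg hα0.le (hnonneg k l)) (mul_nonneg hβ0.le (hnonneg i l))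
        have hnn : ∀ p l l', 0 ≤ Function.update a p b l l' := fun p l l' => by
          rcases eq_or_ne l p with rfl | hl
          · rw [Function.update_self]; exact hb0 l'
          · rw [Function.update_of_ne hl]; exact hnonneg l l'
        have hsub : ∀ p, zdot (w j₀) (a p) ≠ 0 → (Matrix.of (Function.update a p b)).det ≠ 0 →
            HasReciprocity φ d (fun I => halfOpenCone (Function.update a p b) (v I)) := by
          intro p hp hdet
          refine ihn _ ?_ _ hdet (hnn p)
            (fun j hj => (hJ j hj).update p hα0.le hβ0.le hb) rfl
          rw [← hn]
          refine Finset.card_lt_card (Finset.ssubset_iff_of_subset ?_ |>.mpr ⟨p, ?_, ?_⟩)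
          · intro l
            rcases eq_or_ne l p with rfl | hl
            · simp [hwb]
            · simp [hl]
          · simpa using hp
          · simp [hwb]
        have hdeti : (Matrix.of (Function.update a i b)).det ≠ 0 := by
          rw [hb, det_update_combination a hik]
          exact mul_ne_zero hβ0.ne' ha
        have hdetk : (Matrix.of (Function.update a k b)).det ≠ 0 := by
          rw [hb, add_comm, det_update_combination a hik.symm]
          exact mul_ne_zero hα0.ne' ha
        have hsplit := fun I => halfOpenCone_eq_union ha hik hα0 hβ0 (hv I)
        have := (hsub i hi.ne hdeti).union (hsub k hk.ne' hdetk)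
          (fun I e he => nonneg_of_mem_halfOpenCone hdeti (hnn i) he)
          (fun I e he => nonneg_of_mem_halfOpenCone hdetk (hnn k) he)
          (fun I => (hsplit I).2)
        have heq : (fun I => halfOpenCone a (v I)) = fun I =>
            halfOpenCone (Function.update a i b) (v I) ∪
              halfOpenCone (Function.update a k b) (v I) := funext fun I => (hsplit I).1
        rwa [heq]

theorem exists_pos_isGeneric (m : ℕ) : ∃ v : Fin m → ℝ, (∀ i, 0 < v i) ∧ IsGeneric v := by
  have hpos : 0 < liouvilleNumber ((2 : ℕ) : ℝ) := by
    have h2 : (1 : ℝ) < ((2 : ℕ) : ℝ) := by norm_num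
    have h := LiouvilleNumber.partialSum_add_remainder h2 0
    have hr := LiouvilleNumber.remainder_pos h2 0
    have hp : 0 ≤ LiouvilleNumber.partialSum ((2 : ℕ) : ℝ) 0 :=
      Finset.sum_nonneg fun _ _ => by positivity
    linarith
  refine ⟨fun i => liouvilleNumber ((2 : ℕ) : ℝ) ^ (i : ℕ), fun i => pow_pos hpos _, fun c hc => ?_⟩
  by_contra hne
  refine transcendental_liouvilleNumber (m := 2) le_rfl
    ⟨∑ i : Fin m, Polynomial.monomial (i : ℕ) (c i), fun h0 => hne ?_, ?_⟩
  · ext i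
    have := congrArg (fun p => Polynomial.coeff p (i : ℕ)) h0
    simpa [Polynomial.finsetSum_coeff, Polynomial.coeff_monomial, Fin.val_inj] using this
  · simpa [Polynomial.aeval_monomial] using hc

theorem of_single_one : (Matrix.of fun i : Fin m => (Pi.single i 1 : Fin m → ℤ)) = 1 := by
  ext i j
  simp [Matrix.one_apply, Pi.single_apply, eq_comm]

/-- The standard orthant with the facets `e i = 0`, `i ∈ I`, removed. -/
theorem halfOpenCone_one {v : Fin m → ℝ} {I : Finset (Fin m)}
    (hv : ∀ i, 0 < v i ↔ i ∉ I) :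
    halfOpenCone (fun i => Pi.single i 1) v = {e | (∀ i, 0 ≤ e i) ∧ ∀ i ∈ I, 0 < e i} := by
  have hc : ∀ x : Fin m → ℝ, rowCoord (fun i => Pi.single i 1) x = x := fun x => by
    apply rowCoord_eq
    · simp [of_single_one]
    · simp [of_single_one]
  ext e
  simp only [halfOpenCone, hc, LexPos, Set.mem_ofPred_eq, hv, Int.cast_pos, Int.cast_eq_zero]
  constructor
  · intro h
    refine ⟨fun i => ?_, fun i hi => ?_⟩
    · rcases h i with h | h <;> omega
    · rcases h i with h | h
      · exact h
      · exact absurd hi h.2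
  · rintro ⟨h, h'⟩ i
    by_cases hi : i ∈ I
    · exact Or.inl (h' i hi)
    · rcases (h i).lt_or_eq with h0 | h0
      · exact Or.inl h0
      · exact Or.inr ⟨h0.symm, hi⟩

end HalfOpenCones

/-- Theorem 2.3 of the paper for the simple cone `C = ℝ≥0^m`: the generating
functions `E_I(q,q^{-s}) = ∑_{e ∈ C_I ∩ ℤ^m} q^{(A+γ(F_e))·e − (B·e)s}` are rational
in `q, q^{-s}` (witnessed by polynomials `P I, Q I` in two variables evaluated at
`(q, q^{-s})` wherever the defining series converges), and satisfy the reciprocity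
`E_I|_{q→q⁻¹} = (−1)^m E_{[m]∖I}`, expressed in `ℚ(q,t)` by substituting the
inverted variables into the rational function `P I / Q I`. -/
theorem stmt18 (m κ : ℕ) (hm : 1 ≤ m) (A B : Fin m → ℤ)
    (hB : ∀ e : Fin m → ℤ, (∀ i, 0 ≤ e i) → e ≠ 0 → 0 < zdot B e)
    (w : Fin κ → (Fin m → ℤ))
    (γ : (Fin m → ℤ) → (Fin m → ℤ))
    (hγcell : ∀ e e' : Fin m → ℤ, (∀ i, 0 ≤ e i) → (∀ i, 0 ≤ e' i) →
        zSameCell w e e' → γ e = γ e')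
    (hpc : ∀ e : Fin m → ℤ, (∀ i, 0 ≤ e i) →
        ∃ CF : Fin m → ℤ, ∀ e' : Fin m → ℤ, (∀ i, 0 ≤ e' i) →
          zInClosure w e e' → zdot CF e' = zdot (γ e') e') :
    ∃ P Q : Finset (Fin m) → MvPolynomial (Fin 2) ℚ,
      (∀ I, Q I ≠ 0) ∧
      (∀ I : Finset (Fin m), ∀ (q : ℝ) (s : ℂ), 1 < q →
        Summable (fun e : {e : Fin m → ℤ // ∀ i, 0 ≤ e i} =>
          (q : ℝ) ^ (((zdot (A + γ e.1) e.1 : ℤ) : ℝ) - ((zdot B e.1 : ℤ) : ℝ) * s.re)) →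
        (MvPolynomial.aeval
            (fun j : Fin 2 => if j = 0 then (q : ℂ) else (q : ℂ) ^ (-s)) (Q I)) *
          (∑' e : {e : Fin m → ℤ // (∀ i, 0 ≤ e i) ∧ ∀ i ∈ I, 0 < e i},
            (q : ℂ) ^ (((zdot (A + γ e.1) e.1 : ℤ) : ℂ) - ((zdot B e.1 : ℤ) : ℂ) * s)) =
        MvPolynomial.aeval
          (fun j : Fin 2 => if j = 0 then (q : ℂ) else (q : ℂ) ^ (-s)) (P I)) ∧
      (∀ I : Finset (Fin m),
        MvPolynomial.aeval
            (fun j : Fin 2 => (algebraMap (MvPolynomial (Fin 2) ℚ)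
              (FractionRing (MvPolynomial (Fin 2) ℚ)) (MvPolynomial.X j))⁻¹) (P I) *
          algebraMap (MvPolynomial (Fin 2) ℚ) (FractionRing (MvPolynomial (Fin 2) ℚ))
            (Q (Finset.univ \ I)) =
        (-1 : FractionRing (MvPolynomial (Fin 2) ℚ)) ^ m *
          algebraMap (MvPolynomial (Fin 2) ℚ) (FractionRing (MvPolynomial (Fin 2) ℚ))
            (P (Finset.univ \ I)) *
          MvPolynomial.aeval
            (fun j : Fin 2 => (algebraMap (MvPolynomial (Fin 2) ℚ)
              (FractionRing (MvPolynomial (Fin 2) ℚ)) (MvPolynomial.X j))⁻¹) (Q I)) := by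
  set φ : (Fin m → ℤ) → ℤ := fun e => zdot (A + γ e) e with hφ
  obtain ⟨r, hr, hgen⟩ := exists_pos_isGeneric m
  set v : Finset (Fin m) → Fin m → ℝ := fun I i => if i ∈ I then -r i else r i with hv
  have hvgen : ∀ I, IsGeneric (v I) := fun I c hc => by
    have h0 := hgen (fun i => if i ∈ I then -c i else c i) (by
      rw [← hc]
      refine Finset.sum_congr rfl fun i _ => ?_
      by_cases hi : i ∈ I <;> simp [hv, hi])
    ext i
    have := congrFun h0 i
    by_cases hi : i ∈ I <;> simpa [hi] using this
  have hvcompl : ∀ I, v (Finset.univ \ I) = -v I := fun I => by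
    ext i
    by_cases hi : i ∈ I <;> simp [hv, hi]
  have hvpos : ∀ I i, 0 < v I i ↔ i ∉ I := fun I i => by
    by_cases hi : i ∈ I <;> simp [hv, hi, hr i, (hr i).le]
  have hbase : ∀ a : Fin m → Fin m → ℤ, (Matrix.of a).det ≠ 0 → (∀ i k, 0 ≤ a i k) →
      (∀ j, IsOneSided (w j) a) → HasReciprocity φ B (fun I => halfOpenCone a (v I)) := by
    intro a ha hnonneg hw
    obtain ⟨C, hC⟩ := hpc (∑ i, a i) fun k => by
      rw [Finset.sum_apply]
      exact Finset.sum_nonneg fun i _ => hnonneg i k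
    refine hasReciprocity_halfOpenCone (c := A + C) hB ha hnonneg hvgen hvcompl fun e he => ?_
    have he0 : ∀ k, 0 ≤ e k := fun k => by
      have : (0 : ℝ) ≤ e k := by
        rw [← sum_rowCoord ha (fun k => (e k : ℝ)) k]
        exact Finset.sum_nonneg fun i _ => mul_nonneg (he i) (by exact_mod_cast hnonneg i k)
      exact_mod_cast this
    have := hC e he0 (zInClosure_sum_rows ha hnonneg hw he)
    simp only [zdot_eq_dotProduct, hφ, add_dotProduct] at this ⊢
    rw [this]
  have hdet : (Matrix.of fun i : Fin m => (Pi.single i 1 : Fin m → ℤ)).det ≠ 0 := by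
    rw [of_single_one, Matrix.det_one]
    exact one_ne_zero
  obtain ⟨Q, P, hQ, hsum, hrec⟩ := hasReciprocity_of_forall_isOneSided w hvgen hbase Finset.univ
    (fun i => Pi.single i 1) hdet (fun i k => by
      by_cases h : k = i <;> simp [h]) (fun j hj => absurd (Finset.mem_univ j) hj)
  refine ⟨P, fun _ => Q, fun _ => hQ, fun I q s hq hs => ?_, hrec⟩
  have hsφ : Summable ({e : Fin m → ℤ | ∀ i, 0 ≤ e i}.indicator (zetaTerm φ B q s)) := by
    rw [← summable_subtype_iff_indicator, ← summable_norm_iff]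
    refine hs.congr fun e => ?_
    simp [zetaTerm, hφ, Complex.norm_cpow_eq_rpow_re_of_pos (zero_lt_one.trans hq)]
  have h := hsum I q s hq hsφ
  beta_reduce at h
  rw [halfOpenCone_one (hvpos I), ← tsum_subtype] at h
  exact h
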